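/- arXiv:2111.12920 — 4 statements merged into one kernel-verified Lean document; each statement's English description precedes it below -/
import Mathlib

section
/- Let R be a commutative ring, s a natural number, and let a : Fin s → Fin s → ℝ and b : Fin s → ℝ be Runge-Kutta coefficients satisfying the symplectic condition b i * a i j + b j * a j i - b i * b j = 0 for all i, j. Let Δt ∈ ℝ (acting on R via scalar multiplication, or take R an ℝ-algebra), let φⁿ, qⁿ ∈ R and k : Fin s → R be arbitrary, and define the stage values φᵢ = φⁿ + Δt • Σⱼ a i j • kⱼ, lᵢ = 2 φᵢ kᵢ, and the updates φ^{n+1} = φⁿ + Δt • Σᵢ b i • kᵢ and q^{n+1} = qⁿ + Δt • Σᵢ b i • lᵢ. Then q^{n+1} - qⁿ = (φ^{n+1})² - (φⁿ)². -/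
open Finset

/-- Under the symplectic condition on `(a, b)`, the square of a weighted sum is twice the
weighted sum of the products of the stages with the stage sums. -/
theorem sq_sum_smul_of_symplectic {S R ι : Type*} [CommRing S] [CommRing R] [Algebra S R]
    [Fintype ι] {a : ι → ι → S} {b : ι → S}
    (h : ∀ i j, b i * a i j + b j * a j i - b i * b j = 0) (k : ι → R) :
    (∑ i, b i • k i) ^ 2 = 2 * ∑ i, b i • (k i * ∑ j, a i j • k j) := by
  have hswap : ∑ i, ∑ j, (b j * a j i) • (k i * k j) = ∑ i, ∑ j, (b i * a i j) • (k i * k j) := by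
    rw [sum_comm]
    exact sum_congr rfl fun i _ => sum_congr rfl fun j _ => by rw [mul_comm (k j)]
  calc (∑ i, b i • k i) ^ 2
      = ∑ i, ∑ j, (b i * b j) • (k i * k j) := by
        simp only [sq, sum_mul_sum, smul_mul_smul_comm]
    _ = ∑ i, ∑ j, ((b i * a i j) • (k i * k j) + (b j * a j i) • (k i * k j)) := by
        refine sum_congr rfl fun i _ => sum_congr rfl fun j _ => ?_
        rw [← add_smul, sub_eq_zero.mp (h i j)]
    _ = 2 * ∑ i, ∑ j, (b i * a i j) • (k i * k j) := by
        simp only [sum_add_distrib, hswap, two_mul]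
    _ = 2 * ∑ i, b i • (k i * ∑ j, a i j • k j) := by
        simp only [mul_sum, smul_sum, mul_smul_comm, smul_smul]

/-- One-step quadratic-invariant identity for the Runge–Kutta IEQ scheme:
under the symplectic condition, the increment of the auxiliary variable `q`
equals the increment of `φ²`. -/
theorem ieq_rk_q_increment_eq_phi_sq_increment
    {R : Type*} [CommRing R] [Algebra ℝ R] (s : ℕ)
    (a : Fin s → Fin s → ℝ) (b : Fin s → ℝ)
    (hsym : ∀ i j, b i * a i j + b j * a j i - b i * b j = 0)
    (Δt : ℝ) (φn qn : R) (k : Fin s → R)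
    (φstage : Fin s → R)
    (hφstage : ∀ i, φstage i = φn + Δt • ∑ j, a i j • k j)
    (l : Fin s → R) (hl : ∀ i, l i = 2 * φstage i * k i)
    (φn1 : R) (hφn1 : φn1 = φn + Δt • ∑ i, b i • k i)
    (qn1 : R) (hqn1 : qn1 = qn + Δt • ∑ i, b i • l i) :
    qn1 - qn = φn1 ^ 2 - φn ^ 2 := by
  have hincr : ∑ i, b i • l i
      = 2 * φn * ∑ i, b i • k i + Δt • (2 * ∑ i, b i • (k i * ∑ j, a i j • k j)) := by
    rw [mul_sum, mul_sum, smul_sum, ← sum_add_distrib]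
    refine sum_congr rfl fun i _ => ?_
    rw [hl, hφstage]
    simp only [Algebra.smul_def]
    ring
  rw [hqn1, hφn1, hincr, ← sq_sum_smul_of_symplectic hsym]
  simp only [Algebra.smul_def Δt]
  ring
end

section
/- Let R be a commutative ℝ-algebra, s a natural number, and let a : Fin s → Fin s → ℝ and b : Fin s → ℝ satisfy b i * a i j + b j * a j i - b i * b j = 0 for all i, j. Fix Δt ∈ ℝ, and let φⁿ ∈ R and k : Fin s → R be arbitrary. Define φᵢ = φⁿ + Δt • Σⱼ a i j • kⱼ and lᵢ = 2 φᵢ kᵢ. Then Δt • Σᵢ b i • lᵢ = 2 Δt • Σᵢ b i • (kᵢ · φⁿ) + Δt² • Σᵢ Σⱼ (b i * b j) • (kᵢ · kⱼ). -/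
open Finset

/-- Under the symplectic condition, the quadratic form with coefficients `bᵢ bⱼ` is twice the
one with coefficients `bᵢ aᵢⱼ`. -/
theorem sum_sum_mul_smul_mul_eq_two_smul_of_symplectic
    {ι 𝕜 R : Type*} [Fintype ι] [CommRing 𝕜] [CommRing R] [Algebra 𝕜 R]
    {a : ι → ι → 𝕜} {b : ι → 𝕜}
    (hsym : ∀ i j, b i * a i j + b j * a j i - b i * b j = 0) (k : ι → R) :
    ∑ i, ∑ j, (b i * b j) • (k i * k j) =
      (2 : 𝕜) • ∑ i, ∑ j, (b i * a i j) • (k i * k j) := by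
  have hswap : ∑ i, ∑ j, (b i * a i j) • (k i * k j) =
      ∑ i, ∑ j, (b j * a j i) • (k i * k j) := by
    rw [Finset.sum_comm]
    refine Finset.sum_congr rfl fun i _ => Finset.sum_congr rfl fun j _ => ?_
    rw [mul_comm (k j)]
  rw [two_smul]
  nth_rewrite 2 [hswap]
  simp only [← Finset.sum_add_distrib, ← add_smul]
  refine Finset.sum_congr rfl fun i _ => Finset.sum_congr rfl fun j _ => ?_
  rw [sub_eq_zero.mp (hsym i j)]

/-- Key expansion (equation (q1) of the paper): under the symplectic condition,
`Δt • Σᵢ bᵢ • lᵢ = 2Δt • Σᵢ bᵢ • (kᵢ φⁿ) + Δt² • Σᵢ Σⱼ (bᵢ bⱼ) • (kᵢ kⱼ)`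
where `lᵢ = 2 φᵢ kᵢ` and `φᵢ = φⁿ + Δt Σⱼ aᵢⱼ kⱼ`. -/
theorem ieq_rk_l_sum_expansion
    {R : Type*} [CommRing R] [Algebra ℝ R] (s : ℕ)
    (a : Fin s → Fin s → ℝ) (b : Fin s → ℝ)
    (hsym : ∀ i j, b i * a i j + b j * a j i - b i * b j = 0)
    (Δt : ℝ) (φn : R) (k : Fin s → R)
    (φstage : Fin s → R)
    (hφstage : ∀ i, φstage i = φn + Δt • ∑ j, a i j • k j)
    (l : Fin s → R) (hl : ∀ i, l i = 2 * φstage i * k i) :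
    Δt • ∑ i, b i • l i =
      (2 * Δt) • ∑ i, b i • (k i * φn) +
      (Δt ^ 2) • ∑ i, ∑ j, (b i * b j) • (k i * k j) := by
  rw [sum_sum_mul_smul_mul_eq_two_smul_of_symplectic hsym k]
  simp only [Finset.smul_sum, ← Finset.sum_add_distrib]
  refine Finset.sum_congr rfl fun i _ => ?_
  rw [hl, hφstage]
  simp only [Finset.smul_sum, mul_add, add_mul, Finset.mul_sum, Finset.sum_mul, smul_add]
  congr 1
  · simp only [Algebra.smul_def, map_mul, map_ofNat]
    ring
  · refine Finset.sum_congr rfl fun j _ => ?_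
    simp only [Algebra.smul_def, map_mul, map_pow, map_ofNat]
    ring
end

section
/- Let V be a real inner product space and let L : V →L[ℝ] V be a continuous linear map that is symmetric, i.e., ⟨L x, y⟩ = ⟨x, L y⟩ for all x, y ∈ V. Let s be a natural number and let a : Fin s → Fin s → ℝ, b : Fin s → ℝ satisfy b i * a i j + b j * a j i - b i * b j = 0 for all i, j. Fix Δt ∈ ℝ, φⁿ ∈ V, and k : Fin s → V, and define φᵢ = φⁿ + Δt • Σⱼ a i j • kⱼ and φ^{n+1} = φⁿ + Δt • Σᵢ b i • kᵢ. Then (1/2)⟨φ^{n+1}, L φ^{n+1}⟩ - (1/2)⟨φⁿ, L φⁿ⟩ = Δt • Σᵢ b i • ⟨kᵢ, L φᵢ⟩. -/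
open Finset
open scoped RealInnerProductSpace

/-- For symplectic Runge–Kutta coefficients and a symmetric array `M`, the quadratic form of the
weights is twice the form with coefficients `b i * a i j`. -/
theorem sum_symplectic_mul_symm {ι : Type*} [Fintype ι] (a : ι → ι → ℝ) (b : ι → ℝ)
    (M : ι → ι → ℝ) (hM : ∀ i j, M i j = M j i)
    (hsym : ∀ i j, b i * a i j + b j * a j i - b i * b j = 0) :
    ∑ i, ∑ j, b i * b j * M i j = 2 * ∑ i, ∑ j, b i * a i j * M i j := by
  have hswap : ∑ i, ∑ j, b j * a j i * M i j = ∑ i, ∑ j, b i * a i j * M i j := by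
    rw [Finset.sum_comm]
    simp only [fun i j => hM j i]
  calc ∑ i, ∑ j, b i * b j * M i j
      = ∑ i, ∑ j, (b i * a i j * M i j + b j * a j i * M i j) := by
        refine Finset.sum_congr rfl fun i _ => Finset.sum_congr rfl fun j _ => ?_
        linear_combination -M i j * hsym i j
    _ = 2 * ∑ i, ∑ j, b i * a i j * M i j := by
        simp only [Finset.sum_add_distrib]
        rw [hswap, two_mul]

/-- Quadratic-form telescoping identity (equation (e-1) of the paper):
under the symplectic condition, the change of the quadratic energy
`(1/2)⟪φ, Lφ⟫` over one Runge–Kutta step equals the weighted sum of stage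
contributions. -/
theorem rk_quadratic_form_telescoping
    {V : Type*} [NormedAddCommGroup V] [InnerProductSpace ℝ V]
    (L : V →L[ℝ] V) (hL : ∀ x y : V, ⟪L x, y⟫ = ⟪x, L y⟫)
    (s : ℕ) (a : Fin s → Fin s → ℝ) (b : Fin s → ℝ)
    (hsym : ∀ i j, b i * a i j + b j * a j i - b i * b j = 0)
    (Δt : ℝ) (φn : V) (k : Fin s → V)
    (φstage : Fin s → V)
    (hφstage : ∀ i, φstage i = φn + Δt • ∑ j, a i j • k j)
    (φn1 : V) (hφn1 : φn1 = φn + Δt • ∑ i, b i • k i) :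
    (1 / 2) * ⟪φn1, L φn1⟫ - (1 / 2) * ⟪φn, L φn⟫ =
      Δt * ∑ i, b i * ⟪k i, L (φstage i)⟫ := by
  have hM : ∀ i j, ⟪k i, L (k j)⟫ = ⟪k j, L (k i)⟫ := fun i j => by
    rw [← hL, real_inner_comm]
  have hstage : ∀ i, b i * ⟪k i, L (φstage i)⟫ =
      b i * ⟪k i, L φn⟫ + Δt * ∑ j, b i * a i j * ⟪k i, L (k j)⟫ := fun i => by
    simp only [hφstage, map_add, map_smul, map_sum, inner_add_right, inner_smul_right, inner_sum,
      mul_add, mul_assoc, ← Finset.mul_sum]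
    ring
  have hlin : ⟪∑ i, b i • k i, L φn⟫ = ∑ i, b i * ⟪k i, L φn⟫ := by
    simp only [sum_inner, real_inner_smul_left]
  have hquad : ⟪∑ i, b i • k i, L (∑ i, b i • k i)⟫ =
      2 * ∑ i, ∑ j, b i * a i j * ⟪k i, L (k j)⟫ := by
    rw [← sum_symplectic_mul_symm a b (fun i j => ⟪k i, L (k j)⟫) hM hsym]
    simp only [map_sum, map_smul, sum_inner, inner_sum, real_inner_smul_left, inner_smul_right,
      mul_assoc, Finset.mul_sum]
    exact Finset.sum_congr rfl fun i _ => Finset.sum_congr rfl fun j _ => by rw [hM j i]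
  have hcross : ⟪φn, L (∑ i, b i • k i)⟫ = ⟪∑ i, b i • k i, L φn⟫ := by
    rw [← hL, real_inner_comm]
  simp only [hstage, Finset.sum_add_distrib, ← Finset.mul_sum]
  rw [hφn1, map_add, map_smul]
  simp only [inner_add_left, inner_add_right, real_inner_smul_left, real_inner_smul_right]
  rw [hcross, hquad, hlin]
  ring
end

section
/- Let V be a real inner product space, s a natural number, and let a : Fin s → Fin s → ℝ, b : Fin s → ℝ satisfy b i * a i j + b j * a j i - b i * b j = 0 for all i, j. Fix Δt ∈ ℝ, qⁿ ∈ V, and l : Fin s → V, and define qᵢ = qⁿ + Δt • Σⱼ a i j • lⱼ and q^{n+1} = qⁿ + Δt • Σᵢ b i • lᵢ. Then (1/2)‖q^{n+1}‖² - (1/2)‖qⁿ‖² = Δt • Σᵢ b i • ⟨lᵢ, qᵢ⟩. -/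
open Finset
open scoped RealInnerProductSpace

/-- Under the symplectic condition, the squared norm of `∑ i, b i • l i` is twice the
`a`-weighted sum of inner products. -/
theorem norm_sq_sum_smul_of_symplectic
    {ι V : Type*} [Fintype ι] [NormedAddCommGroup V] [InnerProductSpace ℝ V]
    (a : ι → ι → ℝ) (b : ι → ℝ)
    (hsym : ∀ i j, b i * a i j + b j * a j i - b i * b j = 0) (l : ι → V) :
    ‖∑ i, b i • l i‖ ^ 2 = 2 * ∑ i, b i * ⟪l i, ∑ j, a i j • l j⟫ := by
  have hswap : ∑ i, ∑ j, b i * a i j * ⟪l i, l j⟫ = ∑ i, ∑ j, b j * a j i * ⟪l i, l j⟫ := by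
    rw [Finset.sum_comm]
    simp only [real_inner_comm]
  have hexpand : ∑ i, b i * ⟪l i, ∑ j, a i j • l j⟫ = ∑ i, ∑ j, b i * a i j * ⟪l i, l j⟫ := by
    simp only [inner_sum, real_inner_smul_right, Finset.mul_sum, mul_assoc]
  rw [hexpand, two_mul]
  nth_rewrite 2 [hswap]
  rw [← real_inner_self_eq_norm_sq]
  simp only [sum_inner, inner_sum, real_inner_smul_left, real_inner_smul_right,
    ← Finset.sum_add_distrib]
  refine Finset.sum_congr rfl fun i _ => Finset.sum_congr rfl fun j _ => ?_
  linear_combination b i * b j * real_inner_comm (l i) (l j) - ⟪l i, l j⟫ * hsym i j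

/-- Norm-telescoping identity (equation (e-2) of the paper) for the auxiliary
variable `q` in the Runge–Kutta IEQ scheme: under the symplectic condition,
`(1/2)‖q^{n+1}‖² - (1/2)‖qⁿ‖² = Δt Σᵢ bᵢ ⟪lᵢ, qᵢ⟫`. -/
theorem rk_norm_telescoping
    {V : Type*} [NormedAddCommGroup V] [InnerProductSpace ℝ V]
    (s : ℕ) (a : Fin s → Fin s → ℝ) (b : Fin s → ℝ)
    (hsym : ∀ i j, b i * a i j + b j * a j i - b i * b j = 0)
    (Δt : ℝ) (qn : V) (l : Fin s → V)
    (qstage : Fin s → V)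
    (hqstage : ∀ i, qstage i = qn + Δt • ∑ j, a i j • l j)
    (qn1 : V) (hqn1 : qn1 = qn + Δt • ∑ i, b i • l i) :
    (1 / 2) * ‖qn1‖ ^ 2 - (1 / 2) * ‖qn‖ ^ 2 =
      Δt * ∑ i, b i * ⟪l i, qstage i⟫ := by
  have hquad := norm_sq_sum_smul_of_symplectic a b hsym l
  have hlin : ∑ i, b i * ⟪l i, qstage i⟫ =
      ⟪qn, ∑ i, b i • l i⟫ + Δt * ∑ i, b i * ⟪l i, ∑ j, a i j • l j⟫ := by
    rw [inner_sum, Finset.mul_sum, ← Finset.sum_add_distrib]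
    refine Finset.sum_congr rfl fun i _ => ?_
    rw [hqstage, inner_add_right, real_inner_smul_right, real_inner_smul_right,
      real_inner_comm]
    ring
  rw [hlin, hqn1, norm_add_sq_real, real_inner_smul_right, norm_smul, mul_pow, hquad,
    Real.norm_eq_abs, sq_abs]
  ring
end
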